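/- Let n ≥ 1, d = 2^n, and let ψ, φ ∈ ℂ^d be unit vectors. Set X := |ψ⟩⟨ψ| − |φ⟩⟨φ| and λ := √(1 − |⟨ψ, φ⟩|²). Then: (i) tr(P_{n,4}·((|φ⟩⟨φ|)^{⊗3} ⊗ X)) ≤ λ(1−λ)/d if 0 ≤ λ ≤ 1/2, and ≤ 1/(4d) in general; (ii) tr(P_{n,4}·((|φ⟩⟨φ|)^{⊗2} ⊗ X^{⊗2})) ≤ min{2λ²/d, √2·λ²(1+λ)/d}; (iii) tr(P_{n,4}·(|φ⟩⟨φ| ⊗ X^{⊗3})) ≤ 2λ³(1−λ)/d if 0 ≤ λ ≤ 1/2, and ≤ λ²/(2d) if 1/2 ≤ λ ≤ 1; (iv) tr(P_{n,4}·X^{⊗4}) ≤ 8λ⁴/d. -/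

import Mathlib

open scoped BigOperators

noncomputable section

/-- `t`-fold tensor (Kronecker) power of a matrix, acting on `(ℂ^α)^{⊗t}`. -/
def tpow {α : Type*} [Fintype α] (M : Matrix α α ℂ) (t : ℕ) :
    Matrix (Fin t → α) (Fin t → α) ℂ :=
  Matrix.of fun x y => ∏ i, M (x i) (y i)

/-- The rank-one operator `|ψ⟩⟨ψ|`. -/
def rankOne {α : Type*} (ψ : α → ℂ) : Matrix α α ℂ :=
  Matrix.of fun i j => ψ i * (starRingEnd ℂ) (ψ j)

/-- The operator `U_σ` permuting the `t` tensor factors of `(ℂ^α)^{⊗t}`. -/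
def permOp (α : Type*) [DecidableEq α] {t : ℕ} (σ : Equiv.Perm (Fin t)) :
    Matrix (Fin t → α) (Fin t → α) ℂ :=
  Matrix.of fun x y => if (fun k => x (σ k)) = y then 1 else 0

/-- The projector `P_[t]` onto the symmetric subspace `Sym_t(ℂ^α)`. -/
def symProj (α : Type*) [DecidableEq α] (t : ℕ) :
    Matrix (Fin t → α) (Fin t → α) ℂ :=
  (t.factorial : ℂ)⁻¹ • ∑ σ : Equiv.Perm (Fin t), permOp α σ

/-- Single-qubit Pauli matrices labelled by `𝔽₂²`:
`σ_{(0,0)} = I`, `σ_{(0,1)} = X`, `σ_{(1,0)} = Z`, `σ_{(1,1)} = Y`. -/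
def pauli (a : ZMod 2 × ZMod 2) : Matrix (ZMod 2) (ZMod 2) ℂ :=
  Matrix.of fun x y =>
    if a = (0, 0) then (if x = y then 1 else 0)
    else if a = (0, 1) then (if x = y + 1 then 1 else 0)
    else if a = (1, 0) then (if x = y then (if x = 0 then 1 else -1) else 0)
    else (if x = y + 1 then (if x = 0 then -Complex.I else Complex.I) else 0)

/-- The Pauli operator `W_a`, `a ∈ 𝔽₂^{2n}`, on qubits labelled by a finite type `Q`. -/
def PauliW {Q : Type*} [Fintype Q] (a : Q → ZMod 2 × ZMod 2) :
    Matrix (Q → ZMod 2) (Q → ZMod 2) ℂ :=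
  Matrix.of fun x y => ∏ i, pauli (a i) (x i) (y i)

/-- The stabilizer projector `P_{n,k} = 2^{-2n}·Σ_{a∈𝔽₂^{2n}} W_a^{⊗k}`. -/
def stabProj (n k : ℕ) :
    Matrix (Fin k → (Fin n → ZMod 2)) (Fin k → (Fin n → ZMod 2)) ℂ :=
  ((2 : ℂ) ^ (2 * n))⁻¹ • ∑ a : Fin n → ZMod 2 × ZMod 2, tpow (PauliW a) k

/-- A single-qubit gate `G` applied to qubit `i` of `n` qubits (identity elsewhere). -/
def embedGate (n : ℕ) (G : Matrix (ZMod 2) (ZMod 2) ℂ) (i : Fin n) :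
    Matrix (Fin n → ZMod 2) (Fin n → ZMod 2) ℂ :=
  Matrix.of fun x y =>
    G (x i) (y i) * ∏ k ∈ Finset.univ.erase i, (if x k = y k then (1 : ℂ) else 0)

/-- The Hadamard gate `((1+i)/2)·[[1,1],[1,−1]]`. -/
def hGate : Matrix (ZMod 2) (ZMod 2) ℂ :=
  Matrix.of fun x y => (1 + Complex.I) / 2 * (if x = 1 ∧ y = 1 then -1 else 1)

/-- The phase gate `diag(1, −i)`. -/
def sGate : Matrix (ZMod 2) (ZMod 2) ℂ :=
  Matrix.of fun x y => if x = y then (if x = 0 then 1 else -Complex.I) else 0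

/-- The CNOT gate with control qubit `i` and target qubit `j`. -/
def cnotGate (n : ℕ) (i j : Fin n) :
    Matrix (Fin n → ZMod 2) (Fin n → ZMod 2) ℂ :=
  Matrix.of fun x y =>
    if x i = y i ∧ x j = y i + y j ∧ ∀ k, k ≠ i → k ≠ j → x k = y k then 1 else 0

/-- Generators of the `n`-qubit Clifford group: Hadamard and phase gates on each qubit,
CNOT gates on each ordered pair of distinct qubits. -/
def cliffordGens (n : ℕ) : Set (Matrix (Fin n → ZMod 2) (Fin n → ZMod 2) ℂ) :=
  (⋃ i : Fin n, {embedGate n hGate i}) ∪ (⋃ i : Fin n, {embedGate n sGate i}) ∪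
    ⋃ (i : Fin n) (j : Fin n) (_ : i ≠ j), {cnotGate n i j}

/-- The `n`-qubit Clifford group: the subgroup of the unitary group `U(2^n)` generated by
the Hadamard and phase gates on each qubit together with the CNOT gates. -/
def CliffordGroup (n : ℕ) : Subgroup (Matrix.unitaryGroup (Fin n → ZMod 2) ℂ) :=
  Subgroup.closure
    {U : Matrix.unitaryGroup (Fin n → ZMod 2) ℂ |
      (U : Matrix (Fin n → ZMod 2) (Fin n → ZMod 2) ℂ) ∈ cliffordGens n}

/-- Tensor product `A_1 ⊗ ⋯ ⊗ A_k` of `k` matrices, acting on `(ℂ^α)^{⊗k}`. -/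
def tensorFun {α : Type*} [Fintype α] {k : ℕ} (A : Fin k → Matrix α α ℂ) :
    Matrix (Fin k → α) (Fin k → α) ℂ :=
  Matrix.of fun x y => ∏ i, A i (x i) (y i)

section StabProjBounds

open Matrix

section Pauli

theorem zmod_two_eq_zero_or_one (x : ZMod 2) : x = 0 ∨ x = 1 := by
  revert x; decide

theorem zmod_two_sum {M : Type*} [AddCommMonoid M] (f : ZMod 2 → M) : ∑ z, f z = f 0 + f 1 :=
  Fin.sum_univ_two f

theorem pauli_conjTranspose (a : ZMod 2 × ZMod 2) : (pauli a)ᴴ = pauli a := by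
  obtain ⟨a, b⟩ := a
  ext x y
  obtain rfl | rfl := zmod_two_eq_zero_or_one a <;>
    obtain rfl | rfl := zmod_two_eq_zero_or_one b <;>
    obtain rfl | rfl := zmod_two_eq_zero_or_one x <;>
    obtain rfl | rfl := zmod_two_eq_zero_or_one y <;>
    simp [pauli, conjTranspose_apply, CharTwo.add_self_eq_zero]

theorem pauli_mul_self (a : ZMod 2 × ZMod 2) : pauli a * pauli a = 1 := by
  obtain ⟨a, b⟩ := a
  ext x y
  rw [mul_apply, zmod_two_sum]
  obtain rfl | rfl := zmod_two_eq_zero_or_one a <;>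
    obtain rfl | rfl := zmod_two_eq_zero_or_one b <;>
    obtain rfl | rfl := zmod_two_eq_zero_or_one x <;>
    obtain rfl | rfl := zmod_two_eq_zero_or_one y <;>
    simp [pauli, CharTwo.add_self_eq_zero]

theorem sum_pauli_mul_pauli (x y z w : ZMod 2) :
    ∑ a, pauli a x y * pauli a z w = if x = w ∧ y = z then 2 else 0 := by
  rw [Fintype.sum_prod_type]
  simp only [zmod_two_sum]
  obtain rfl | rfl := zmod_two_eq_zero_or_one x <;>
    obtain rfl | rfl := zmod_two_eq_zero_or_one y <;>
    obtain rfl | rfl := zmod_two_eq_zero_or_one z <;>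
    obtain rfl | rfl := zmod_two_eq_zero_or_one w <;>
    simp [pauli, CharTwo.add_self_eq_zero] <;> norm_num

variable {Q : Type*} [Fintype Q]

theorem PauliW_conjTranspose (a : Q → ZMod 2 × ZMod 2) : (PauliW a)ᴴ = PauliW a := by
  ext x y
  simp only [conjTranspose_apply, PauliW, of_apply, star_prod]
  exact Finset.prod_congr rfl fun i _ => congrFun₂ (pauli_conjTranspose (a i)) (x i) (y i)

variable [DecidableEq Q]

theorem PauliW_mul_self (a : Q → ZMod 2 × ZMod 2) : PauliW a * PauliW a = 1 := by
  ext x y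
  simp only [mul_apply, PauliW, of_apply, ← Finset.prod_mul_distrib]
  rw [← Fintype.prod_sum (fun i z => pauli (a i) (x i) z * pauli (a i) z (y i))]
  simp only [← mul_apply, pauli_mul_self, one_apply, Finset.prod_ite_zero, funext_iff]
  simp

theorem sum_PauliW_mul_PauliW (x y z w : Q → ZMod 2) :
    ∑ a, PauliW a x y * PauliW a z w =
      if x = w ∧ y = z then (2 : ℂ) ^ Fintype.card Q else 0 := by
  simp only [PauliW, of_apply, ← Finset.prod_mul_distrib]
  rw [← Fintype.prod_sum (fun i b => pauli b (x i) (y i) * pauli b (z i) (w i))]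
  simp only [sum_pauli_mul_pauli, Finset.prod_ite_zero, funext_iff]
  simp [forall_and]

theorem sum_trace_PauliW_mul (A B : Matrix (Q → ZMod 2) (Q → ZMod 2) ℂ) :
    ∑ a, trace (PauliW a * A) * trace (PauliW a * B) =
      (2 : ℂ) ^ Fintype.card Q * trace (A * B) := by
  calc ∑ a, trace (PauliW a * A) * trace (PauliW a * B)
      = ∑ x, ∑ y, ∑ z, ∑ w, (∑ a, PauliW a x z * PauliW a y w) * (A z x * B w y) := by
        simp only [trace, diag_apply, mul_apply, Finset.sum_mul]
        rw [Finset.sum_comm]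
        refine Finset.sum_congr rfl fun x _ => ?_
        simp only [Finset.mul_sum]
        rw [Finset.sum_comm]
        simp_rw [Finset.sum_comm (s := Finset.univ (α := Q → ZMod 2 × ZMod 2))]
        rw [Finset.sum_comm]
        refine Finset.sum_congr rfl fun y _ => Finset.sum_congr rfl fun z _ =>
          Finset.sum_congr rfl fun w _ => Finset.sum_congr rfl fun a _ => by ring
    _ = (2 : ℂ) ^ Fintype.card Q * trace (A * B) := by
        simp only [sum_PauliW_mul_PauliW, ite_and, ite_mul, zero_mul, trace, diag_apply,
          mul_apply, Finset.mul_sum]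
        rw [Finset.sum_comm]
        simp

end Pauli

section Tensor

variable {α : Type*} [Fintype α] {k : ℕ}

theorem tpow_mul_tensorFun [DecidableEq α] (M : Matrix α α ℂ) (A : Fin k → Matrix α α ℂ) :
    tpow M k * tensorFun A = tensorFun fun i => M * A i := by
  ext x y
  simp only [mul_apply, tpow, tensorFun, of_apply, ← Finset.prod_mul_distrib]
  rw [← Fintype.prod_sum (fun i z => M (x i) z * A i z (y i))]

theorem trace_tensorFun [DecidableEq α] (A : Fin k → Matrix α α ℂ) :
    trace (tensorFun A) = ∏ i, trace (A i) := by
  simp only [trace, diag_apply, tensorFun, of_apply]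
  rw [← Fintype.prod_sum (fun i z => A i z z)]

theorem tpow_eq_tensorFun (M : Matrix α α ℂ) : tpow M k = tensorFun fun _ => M := rfl

theorem trace_stabProj_mul_tensorFun (n : ℕ)
    (A : Fin k → Matrix (Fin n → ZMod 2) (Fin n → ZMod 2) ℂ) :
    trace (stabProj n k * tensorFun A) =
      ((2 : ℂ) ^ (2 * n))⁻¹ * ∑ a, ∏ i, trace (PauliW a * A i) := by
  simp only [stabProj, smul_mul_assoc, Matrix.sum_mul, trace_smul, trace_sum,
    tpow_mul_tensorFun, trace_tensorFun, smul_eq_mul]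

end Tensor

section RankOne

variable {α : Type*} [Fintype α]

omit [Fintype α] in
theorem rankOne_eq_vecMulVec (φ : α → ℂ) : rankOne φ = vecMulVec φ (star φ) := rfl

theorem trace_mul_rankOne (M : Matrix α α ℂ) (φ : α → ℂ) :
    trace (M * rankOne φ) = star φ ⬝ᵥ M *ᵥ φ := by
  rw [rankOne_eq_vecMulVec, mul_vecMulVec, trace_vecMulVec, dotProduct_comm]

theorem trace_rankOne_mul_rankOne (ψ φ : α → ℂ) :
    trace (rankOne ψ * rankOne φ) = (Complex.normSq (star ψ ⬝ᵥ φ) : ℂ) := by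
  have h : star φ ⬝ᵥ ψ = star (star ψ ⬝ᵥ φ) := star_dotProduct φ ψ
  rw [trace_mul_rankOne, rankOne_eq_vecMulVec, vecMulVec_mulVec, dotProduct_smul, h,
    ← Complex.mul_conj]
  simp [mul_comm]

theorem norm_star_dotProduct_sq_le (f g : α → ℂ) :
    ‖star f ⬝ᵥ g‖ ^ 2 ≤ (star f ⬝ᵥ f).re * (star g ⬝ᵥ g).re := by
  have h := norm_inner_le_norm (𝕜 := ℂ) (WithLp.toLp 2 f) (WithLp.toLp 2 g)
  have h1 (v w : α → ℂ) : inner ℂ (WithLp.toLp 2 v) (WithLp.toLp 2 w) = star v ⬝ᵥ w := by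
    rw [EuclideanSpace.inner_toLp_toLp, dotProduct_comm]
  have h2 (v : α → ℂ) : (star v ⬝ᵥ v).re = ‖WithLp.toLp 2 v‖ ^ 2 := by
    rw [← h1, inner_self_eq_norm_sq_to_K]
    norm_cast
  rw [h2, h2, ← h1, ← mul_pow]
  gcongr

theorem star_mulVec_dotProduct {W : Matrix α α ℂ} (hW : Wᴴ = W) (f g : α → ℂ) :
    star (W *ᵥ f) ⬝ᵥ g = star f ⬝ᵥ W *ᵥ g := by
  rw [star_mulVec, hW, dotProduct_mulVec]

theorem star_dotProduct_mulVec_eq_re {W : Matrix α α ℂ} (hW : Wᴴ = W) (f : α → ℂ) :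
    star f ⬝ᵥ W *ᵥ f = ((star f ⬝ᵥ W *ᵥ f).re : ℂ) := by
  refine (Complex.conj_eq_iff_re.mp ?_).symm
  rw [starRingEnd_apply, ← star_dotProduct, star_mulVec_dotProduct hW]

variable [DecidableEq α]

/-- For a Hermitian unitary `W`, the Cauchy–Schwarz inequality for the form `1 + W`. -/
theorem norm_add_reflection_sq_le {W : Matrix α α ℂ} (hW : Wᴴ = W) (hWW : W * W = 1)
    {ψ φ : α → ℂ} (hψ : star ψ ⬝ᵥ ψ = 1) (hφ : star φ ⬝ᵥ φ = 1) :
    ‖star ψ ⬝ᵥ φ + star ψ ⬝ᵥ W *ᵥ φ‖ ^ 2 ≤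
      (1 + (star ψ ⬝ᵥ W *ᵥ ψ).re) * (1 + (star φ ⬝ᵥ W *ᵥ φ).re) := by
  have key (f g : α → ℂ) : star (f + W *ᵥ f) ⬝ᵥ (g + W *ᵥ g) =
      2 * (star f ⬝ᵥ g + star f ⬝ᵥ W *ᵥ g) := by
    rw [star_add, add_dotProduct, dotProduct_add, dotProduct_add, star_mulVec_dotProduct hW,
      star_mulVec_dotProduct hW, mulVec_mulVec, hWW, one_mulVec]
    ring
  have h := norm_star_dotProduct_sq_le (ψ + W *ᵥ ψ) (φ + W *ᵥ φ)
  rw [key, key, key, hψ, hφ, norm_mul, mul_pow] at h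
  simp only [Complex.norm_ofNat, Complex.mul_re, Complex.re_ofNat, Complex.im_ofNat, zero_mul,
    sub_zero, Complex.add_re, Complex.one_re] at h
  linarith

theorem abs_re_reflection_le_one {W : Matrix α α ℂ} (hW : Wᴴ = W) (hWW : W * W = 1)
    {φ : α → ℂ} (hφ : star φ ⬝ᵥ φ = 1) : |(star φ ⬝ᵥ W *ᵥ φ).re| ≤ 1 := by
  have h := norm_star_dotProduct_sq_le φ (W *ᵥ φ)
  rw [star_mulVec_dotProduct hW, mulVec_mulVec, hWW, one_mulVec, hφ] at h
  simp only [Complex.one_re, mul_one] at h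
  exact (Complex.abs_re_le_norm _).trans ((sq_le_one_iff₀ (norm_nonneg _)).mp h)

/-- Joint constraint on the expectation values of a Hermitian unitary in two unit vectors. -/
theorem reflection_overlap_le {W : Matrix α α ℂ} (hW : Wᴴ = W) (hWW : W * W = 1)
    {ψ φ : α → ℂ} (hψ : star ψ ⬝ᵥ ψ = 1) (hφ : star φ ⬝ᵥ φ = 1) :
    2 * Complex.normSq (star ψ ⬝ᵥ φ) -
        1 - (star ψ ⬝ᵥ W *ᵥ ψ).re * (star φ ⬝ᵥ W *ᵥ φ).re ≤
      √((1 - (star ψ ⬝ᵥ W *ᵥ ψ).re ^ 2) * (1 - (star φ ⬝ᵥ W *ᵥ φ).re ^ 2)) := by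
  have hp := abs_le.mp (abs_re_reflection_le_one hW hWW hφ)
  have hq := abs_le.mp (abs_re_reflection_le_one hW hWW hψ)
  have h1 := norm_add_reflection_sq_le hW hWW hψ hφ
  have h2 := norm_add_reflection_sq_le (W := -W) (by rw [conjTranspose_neg, hW])
    (by rw [neg_mul_neg, hWW]) hψ hφ
  simp only [neg_mulVec, dotProduct_neg, Complex.neg_re, ← sub_eq_add_neg] at h2
  rw [Complex.normSq_eq_norm_sq]
  set c := star ψ ⬝ᵥ φ
  set e := star ψ ⬝ᵥ W *ᵥ φ
  set p := (star φ ⬝ᵥ W *ᵥ φ).re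
  set q := (star ψ ⬝ᵥ W *ᵥ ψ).re
  have h3 : 2 * ‖c‖ ≤ ‖c + e‖ + ‖c - e‖ := by
    have := norm_add_le (c + e) (c - e)
    rwa [show c + e + (c - e) = 2 * c by ring, norm_mul, Complex.norm_ofNat] at this
  have h4 : ‖c + e‖ * ‖c - e‖ ≤ √((1 - q ^ 2) * (1 - p ^ 2)) := by
    refine Real.le_sqrt_of_sq_le ?_
    rw [mul_pow, show (1 - q ^ 2) * (1 - p ^ 2) =
      ((1 + q) * (1 + p)) * ((1 - q) * (1 - p)) by ring]
    exact mul_le_mul h1 h2 (sq_nonneg _) (by nlinarith)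
  nlinarith [norm_nonneg c, norm_nonneg (c + e), norm_nonneg (c - e),
    mul_self_le_mul_self (by positivity) h3]

end RankOne

section Scalar

variable {l p q : ℝ}

/-- The three pointwise bounds on expectation values `p`, `q` of a reflection in two pure states
at trace distance `l`. -/
theorem reflection_pointwise_bounds (hl0 : 0 ≤ l) (hl1 : l ≤ 1) (hp : |p| ≤ 1) (hq : |q| ≤ 1)
    (h : 1 - 2 * l ^ 2 - q * p ≤ √((1 - q ^ 2) * (1 - p ^ 2))) :
    (q - p) ^ 2 ≤ 4 * l ^ 2 ∧ |p * (q - p)| ≤ l * (1 + l) ∧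
      (l ≤ 1 / 2 → p * (q - p) ≤ l * (1 - l)) := by
  have hp2 : p ^ 2 ≤ 1 := (sq_le_one_iff_abs_le_one p).mpr hp
  have hq2 : q ^ 2 ≤ 1 := (sq_le_one_iff_abs_le_one q).mpr hq
  rcases hl1.eq_or_lt with rfl | hl1
  · refine ⟨by nlinarith [sq_nonneg (p + q)], ?_, fun h => by norm_num at h⟩
    rw [abs_le]
    constructor <;> nlinarith [sq_nonneg (p + q), sq_nonneg (p - q)]
  rcases le_or_gt 0 (1 - 2 * l ^ 2 - q * p) with h0 | h0
  · have h1 := (Real.le_sqrt h0 (by nlinarith)).mp h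
    have h2 : (q - p) ^ 2 + 4 * l ^ 2 * p ^ 2 + 4 * l ^ 2 * (p * (q - p)) ≤
        4 * l ^ 2 * (1 - l ^ 2) := by nlinarith
    have hpos : 0 < 1 - l := by linarith
    rcases hl0.eq_or_lt with rfl | hl0
    · have : q - p = 0 := by nlinarith [sq_nonneg (q - p)]
      simp [this]
    have h3 : 4 * l * |p * (q - p)| ≤ (q - p) ^ 2 + 4 * l ^ 2 * p ^ 2 := by
      rw [abs_mul, ← sq_abs (q - p), ← sq_abs p]
      nlinarith [sq_nonneg (|q - p| - 2 * l * |p|)]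
    have h4 : |p * (q - p)| + l * (p * (q - p)) ≤ l * (1 - l ^ 2) := by
      refine le_of_mul_le_mul_left ?_ (by positivity : 0 < 4 * l)
      nlinarith
    refine ⟨?_, ?_, fun _ => ?_⟩
    · refine le_of_mul_le_mul_left ?_ (by nlinarith : 0 < 1 - l ^ 2)
      nlinarith [sq_nonneg (l * (p + q))]
    · refine le_of_mul_le_mul_left ?_ hpos
      nlinarith [neg_abs_le (p * (q - p))]
    · refine le_of_mul_le_mul_left ?_ (by linarith : 0 < 1 + l)
      nlinarith [le_abs_self (p * (q - p))]
  · have hlow : l ^ 2 ≤ l := by nlinarith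
    refine ⟨by nlinarith, ?_, fun hl => ?_⟩
    · rw [abs_le]
      constructor
      · nlinarith
      · nlinarith [sq_nonneg (p - q)]
    · have h1 : p * (q - p) ≤ |p| * (1 - |p|) := by
        have : p * q ≤ |p| * 1 :=
          (le_abs_self _).trans ((abs_mul p q).le.trans (by gcongr))
        nlinarith [sq_abs p]
      have h2 : 1 - 2 * l ^ 2 ≤ |p| := by
        have : q * p ≤ 1 * |p| :=
          (le_abs_self _).trans ((abs_mul q p).le.trans (by gcongr))
        linarith
      have h3 : 0 ≤ (1 - 2 * l) ^ 2 * (1 + l) := by positivity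
      nlinarith [mul_nonneg hl0 h3, mul_nonneg (sub_nonneg.2 h2) (sub_nonneg.2 h2)]

end Scalar

section Sums

variable {ι : Type*} {p x : ι → ℝ} {s : Finset ι} {d l M : ℝ}

theorem sum_cube_mul_le (hM : ∀ a ∈ s, p a * x a ≤ M) (hp : ∑ a ∈ s, p a ^ 2 = d) :
    ∑ a ∈ s, p a * p a * p a * x a ≤ M * d := by
  rw [← hp, Finset.mul_sum]
  exact Finset.sum_le_sum fun a ha => by nlinarith [hM a ha, sq_nonneg (p a)]

theorem sum_mul_cube_le (hM : ∀ a ∈ s, p a * x a ≤ M) (hx : ∑ a ∈ s, x a ^ 2 = d) :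
    ∑ a ∈ s, p a * x a * x a * x a ≤ M * d := by
  rw [← hx, Finset.mul_sum]
  exact Finset.sum_le_sum fun a ha => by nlinarith [hM a ha, sq_nonneg (x a)]

theorem sum_sq_mul_sq_le (hp1 : ∀ a ∈ s, |p a| ≤ 1) (hx : ∑ a ∈ s, x a ^ 2 = d) :
    ∑ a ∈ s, p a * p a * x a * x a ≤ d := by
  rw [← hx]
  refine Finset.sum_le_sum fun a ha => ?_
  nlinarith [(sq_le_one_iff_abs_le_one (p a)).mpr (hp1 a ha), sq_nonneg (x a)]

theorem sum_sq_mul_sq_le_sqrt (hd : 0 ≤ d) (hl : 0 ≤ l) (hM0 : 0 ≤ M)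
    (hM : ∀ a ∈ s, |p a * x a| ≤ M)
    (hp : ∑ a ∈ s, p a ^ 2 = d) (hx : ∑ a ∈ s, x a ^ 2 = 2 * d * l ^ 2) :
    ∑ a ∈ s, p a * p a * x a * x a ≤ M * (√2 * l * d) := by
  have h1 : ∑ a ∈ s, |p a| * |x a| ≤ √2 * l * d := by
    have h := Finset.sum_mul_sq_le_sq_mul_sq s (fun a => |p a|) (fun a => |x a|)
    simp only [sq_abs, hp, hx] at h
    refine (sq_le_sq₀ (Finset.sum_nonneg fun a _ => by positivity) (by positivity)).mp
      (h.trans_eq ?_)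
    rw [mul_pow, mul_pow, Real.sq_sqrt zero_le_two]
    ring
  refine le_trans ?_ (mul_le_mul_of_nonneg_left h1 hM0)
  rw [Finset.mul_sum]
  refine Finset.sum_le_sum fun a ha => ?_
  rw [← abs_mul, show p a * p a * x a * x a = |p a * x a| * |p a * x a| by
    rw [abs_mul_abs_self]; ring]
  exact mul_le_mul_of_nonneg_right (hM a ha) (abs_nonneg _)

theorem sum_pow_four_le (hM : ∀ a ∈ s, x a ^ 2 ≤ M) (hx : ∑ a ∈ s, x a ^ 2 = d) :
    ∑ a ∈ s, x a * x a * x a * x a ≤ M * d := by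
  rw [← hx, Finset.mul_sum]
  exact Finset.sum_le_sum fun a ha => by nlinarith [hM a ha, sq_nonneg (x a)]

end Sums

section Expectation

variable {Q : Type*} [Fintype Q] [DecidableEq Q] {ψ φ : (Q → ZMod 2) → ℂ}

/-- The expectation value `⟨φ, W_a φ⟩` of a Pauli operator, a real number. -/
def pauliExp (φ : (Q → ZMod 2) → ℂ) (a : Q → ZMod 2 × ZMod 2) : ℝ :=
  (star φ ⬝ᵥ PauliW a *ᵥ φ).re

theorem trace_PauliW_mul_rankOne (φ : (Q → ZMod 2) → ℂ) (a : Q → ZMod 2 × ZMod 2) :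
    trace (PauliW a * rankOne φ) = (pauliExp φ a : ℂ) := by
  rw [trace_mul_rankOne, star_dotProduct_mulVec_eq_re (PauliW_conjTranspose a), pauliExp]

theorem trace_PauliW_mul_rankOne_sub (ψ φ : (Q → ZMod 2) → ℂ) (a : Q → ZMod 2 × ZMod 2) :
    trace (PauliW a * (rankOne ψ - rankOne φ)) = ((pauliExp ψ a - pauliExp φ a : ℝ) : ℂ) := by
  rw [Matrix.mul_sub, trace_sub, trace_PauliW_mul_rankOne, trace_PauliW_mul_rankOne,
    Complex.ofReal_sub]

theorem sum_pauliExp_mul (ψ φ : (Q → ZMod 2) → ℂ) :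
    ∑ a, pauliExp ψ a * pauliExp φ a =
      (2 : ℝ) ^ Fintype.card Q * Complex.normSq (star ψ ⬝ᵥ φ) := by
  have h := sum_trace_PauliW_mul (rankOne ψ) (rankOne φ)
  simp only [trace_PauliW_mul_rankOne, trace_rankOne_mul_rankOne] at h
  exact_mod_cast h

theorem sum_pauliExp_sq (hφ : star φ ⬝ᵥ φ = 1) :
    ∑ a, pauliExp φ a ^ 2 = (2 : ℝ) ^ Fintype.card Q := by
  simp only [sq, sum_pauliExp_mul, hφ, map_one, mul_one]

theorem sum_pauliExp_sub_sq (hψ : star ψ ⬝ᵥ ψ = 1) (hφ : star φ ⬝ᵥ φ = 1) :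
    ∑ a, (pauliExp ψ a - pauliExp φ a) ^ 2 =
      2 * (2 : ℝ) ^ Fintype.card Q * (1 - Complex.normSq (star ψ ⬝ᵥ φ)) := by
  simp only [sub_sq, Finset.sum_add_distrib, Finset.sum_sub_distrib, sum_pauliExp_sq hψ,
    sum_pauliExp_sq hφ, mul_assoc, ← Finset.mul_sum, sum_pauliExp_mul]
  ring

theorem abs_pauliExp_le_one (hφ : star φ ⬝ᵥ φ = 1) (a : Q → ZMod 2 × ZMod 2) :
    |pauliExp φ a| ≤ 1 :=
  abs_re_reflection_le_one (PauliW_conjTranspose a) (PauliW_mul_self a) hφ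

end Expectation

section Traces

theorem trace_stabProj_mul_eq_ofReal {n : ℕ}
    {A : Fin 4 → Matrix (Fin n → ZMod 2) (Fin n → ZMod 2) ℂ}
    {f : Fin 4 → (Fin n → ZMod 2 × ZMod 2) → ℝ}
    (h : ∀ i a, trace (PauliW a * A i) = (f i a : ℂ)) :
    trace (stabProj n 4 * tensorFun A) =
      (((∑ a, f 0 a * f 1 a * f 2 a * f 3 a) / ((2 : ℝ) ^ n) ^ 2 : ℝ) : ℂ) := by
  rw [trace_stabProj_mul_tensorFun]
  simp only [Fin.prod_univ_four, h]
  push_cast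
  rw [div_eq_inv_mul, ← pow_mul, mul_comm n 2]

end Traces

end StabProjBounds

open scoped ComplexOrder

/-- For unit vectors `ψ, φ ∈ ℂ^d`, `d = 2^n`, with
`X = |ψ⟩⟨ψ| − |φ⟩⟨φ|` and `λ = √(1 − |⟨ψ,φ⟩|²)`:
(i) `tr(P_{n,4}((|φ⟩⟨φ|)^{⊗3} ⊗ X)) ≤ λ(1−λ)/d` for `λ ≤ 1/2`, and `≤ 1/(4d)` always;
(ii) `tr(P_{n,4}((|φ⟩⟨φ|)^{⊗2} ⊗ X^{⊗2})) ≤ min{2λ²/d, √2·λ²(1+λ)/d}`;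
(iii) `tr(P_{n,4}(|φ⟩⟨φ| ⊗ X^{⊗3})) ≤ 2λ³(1−λ)/d` for `λ ≤ 1/2`, `≤ λ²/(2d)` for `λ ≥ 1/2`;
(iv) `tr(P_{n,4}·X^{⊗4}) ≤ 8λ⁴/d`. -/
theorem stmt16 (n : ℕ) (hn : 1 ≤ n) (ψ φ : (Fin n → ZMod 2) → ℂ)
    (hψ : ∑ x, (starRingEnd ℂ) (ψ x) * ψ x = 1)
    (hφ : ∑ x, (starRingEnd ℂ) (φ x) * φ x = 1) :
    let d : ℝ := (2 : ℝ) ^ n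
    let lam : ℝ := Real.sqrt (1 - Complex.normSq (∑ x, (starRingEnd ℂ) (ψ x) * φ x))
    let X := rankOne ψ - rankOne φ
    let P := rankOne φ
    ((lam ≤ 1 / 2 →
        Matrix.trace (stabProj n 4 * tensorFun ![P, P, P, X]) ≤
          ((lam * (1 - lam) / d : ℝ) : ℂ)) ∧
      Matrix.trace (stabProj n 4 * tensorFun ![P, P, P, X]) ≤ ((1 / (4 * d) : ℝ) : ℂ)) ∧
    Matrix.trace (stabProj n 4 * tensorFun ![P, P, X, X]) ≤
      ((min (2 * lam ^ 2 / d) (Real.sqrt 2 * lam ^ 2 * (1 + lam) / d) : ℝ) : ℂ) ∧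
    ((lam ≤ 1 / 2 →
        Matrix.trace (stabProj n 4 * tensorFun ![P, X, X, X]) ≤
          ((2 * lam ^ 3 * (1 - lam) / d : ℝ) : ℂ)) ∧
      (1 / 2 ≤ lam →
        Matrix.trace (stabProj n 4 * tensorFun ![P, X, X, X]) ≤
          ((lam ^ 2 / (2 * d) : ℝ) : ℂ))) ∧
    Matrix.trace (stabProj n 4 * tpow X 4) ≤ ((8 * lam ^ 4 / d : ℝ) : ℂ) := by
  intro d lam X P
  have hψ' : star ψ ⬝ᵥ ψ = 1 := hψ
  have hφ' : star φ ⬝ᵥ φ = 1 := hφ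
  have hd : 0 < d := by positivity
  have hc : Complex.normSq (star ψ ⬝ᵥ φ) ≤ 1 := by
    have h := norm_star_dotProduct_sq_le ψ φ
    rwa [hψ', hφ', Complex.one_re, mul_one, ← Complex.normSq_eq_norm_sq] at h
  have hlam0 : 0 ≤ lam := Real.sqrt_nonneg _
  have hlam2 : lam ^ 2 = 1 - Complex.normSq (star ψ ⬝ᵥ φ) := Real.sq_sqrt (sub_nonneg.2 hc)
  have hlam1 : lam ≤ 1 := by
    nlinarith [Complex.normSq_nonneg (star ψ ⬝ᵥ φ)]
  have hb (a) := reflection_pointwise_bounds hlam0 hlam1 (abs_pauliExp_le_one hφ' a)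
    (abs_pauliExp_le_one hψ' a) (by
      have h := reflection_overlap_le (PauliW_conjTranspose a) (PauliW_mul_self a) hψ' hφ'
      rw [show 2 * Complex.normSq (star ψ ⬝ᵥ φ) - 1 = 1 - 2 * lam ^ 2 by rw [hlam2]; ring] at h
      exact h)
  have hquarter (a) : pauliExp φ a * (pauliExp ψ a - pauliExp φ a) ≤ 1 / 4 := by
    nlinarith [sq_nonneg (2 * pauliExp φ a - pauliExp ψ a),
      (sq_le_one_iff_abs_le_one _).mpr (abs_pauliExp_le_one hψ' a)]
  have hp : ∑ a, pauliExp φ a ^ 2 = d := by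
    rw [sum_pauliExp_sq hφ', Fintype.card_fin]
  have hx : ∑ a, (pauliExp ψ a - pauliExp φ a) ^ 2 = 2 * d * lam ^ 2 := by
    rw [sum_pauliExp_sub_sq hψ' hφ', Fintype.card_fin, hlam2]
  have hP (a) : Matrix.trace (PauliW a * P) = (pauliExp φ a : ℂ) := trace_PauliW_mul_rankOne φ a
  have hX (a) : Matrix.trace (PauliW a * X) = ((pauliExp ψ a - pauliExp φ a : ℝ) : ℂ) :=
    trace_PauliW_mul_rankOne_sub ψ φ a
  let p := pauliExp φ
  let x := fun a => pauliExp ψ a - pauliExp φ a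
  have t1 := trace_stabProj_mul_eq_ofReal (A := ![P, P, P, X]) (f := ![p, p, p, x])
    (fun i a => by fin_cases i; exacts [hP a, hP a, hP a, hX a])
  have t2 := trace_stabProj_mul_eq_ofReal (A := ![P, P, X, X]) (f := ![p, p, x, x])
    (fun i a => by fin_cases i; exacts [hP a, hP a, hX a, hX a])
  have t3 := trace_stabProj_mul_eq_ofReal (A := ![P, X, X, X]) (f := ![p, x, x, x])
    (fun i a => by fin_cases i; exacts [hP a, hX a, hX a, hX a])
  have t4 := trace_stabProj_mul_eq_ofReal (A := fun _ => X) (f := fun _ => x) (fun _ a => hX a)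
  have bound {S T M : ℝ} (hS : S ≤ T) (hT : T = M * d ^ 2) : S / d ^ 2 ≤ M := by
    rw [div_le_iff₀ (by positivity)]
    exact hS.trans_eq hT
  rw [tpow_eq_tensorFun, t1, t2, t3, t4]
  simp only [Complex.real_le_real, le_min_iff]
  refine ⟨⟨fun hl => ?_, ?_⟩, ⟨?_, ?_⟩, ⟨fun hl => ?_, fun _ => ?_⟩, ?_⟩
  · exact bound (sum_cube_mul_le (fun a _ => (hb a).2.2 hl) hp) (by field_simp)
  · exact bound (sum_cube_mul_le (fun a _ => hquarter a) hp) (by field_simp)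
  · exact bound (sum_sq_mul_sq_le (fun a _ => abs_pauliExp_le_one hφ' a) hx) (by field_simp)
  · exact bound (sum_sq_mul_sq_le_sqrt hd.le hlam0 (by positivity) (fun a _ => (hb a).2.1) hp hx)
      (by field_simp)
  · exact bound (sum_mul_cube_le (fun a _ => (hb a).2.2 hl) hx) (by field_simp)
  · exact bound (sum_mul_cube_le (fun a _ => hquarter a) hx) (by field_simp; norm_num)
  · exact bound (sum_pow_four_le (fun a _ => (hb a).1) hx) (by field_simp; ring)

end
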